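/- Let r ≥ 1 be an integer and let k be a real number with |k| = 2^r. Then for every complex number s with Re(s) > −r/2, W_r(k;s) = 2^{rs} · ∑_{n≥0} (−s/2)ₙ · ((1−s)/2)ₙ · ((1/2)ₙ)^(r−1) / (n!)^(r+1), i.e. W_r(k;s) = 2^{rs} · ₍r+1₎F_r(−s/2, (1−s)/2, 1/2, …, 1/2; 1, …, 1; 1); the series on the right converges absolutely because the real part of the sum of the lower parameters minus the sum of the upper parameters equals Re(s) + r/2 > 0. -/

import Mathlib

open MeasureTheory Real

/-- `t ^ s` for real `t ≥ 0` and complex `s`, with `0 ^ s := 0`. -/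
noncomputable def cpow0 (t : ℝ) (s : ℂ) : ℂ :=
  if t = 0 then 0 else Complex.exp (s * Real.log t)

/-- Pochhammer symbol `(x)ₙ = x (x+1) ⋯ (x+n-1)` in `ℂ`. -/
noncomputable def poch (x : ℂ) (n : ℕ) : ℂ := (ascPochhammer ℂ n).eval x

/-- The zeta Mahler function
`W_r(k;s) = (2π)^{−r} ∫_{[0,2π]^r} |k + ∏ᵢ 2 cos θᵢ|^s dθ₁⋯dθ_r`. -/
noncomputable def Wr (r : ℕ) (k : ℝ) (s : ℂ) : ℂ :=
  ((2 * π : ℝ) : ℂ)⁻¹ ^ r *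
    ∫ θ : Fin r → ℝ in Set.univ.pi fun _ => Set.Icc 0 (2 * π),
      cpow0 |k + ∏ i, 2 * Real.cos (θ i)| s

open Filter Topology

lemma poch_zero (x : ℂ) : poch x 0 = 1 := by simp [poch]

lemma poch_succ (x : ℂ) (n : ℕ) : poch x (n + 1) = poch x n * (x + n) := by
  simp [poch, ascPochhammer_succ_eval]

lemma poch_eq_prod (x : ℂ) (n : ℕ) : poch x n = ∏ j ∈ Finset.range n, (x + j) := by
  induction n with
  | zero => simp [poch_zero]
  | succ n ih => rw [poch_succ, Finset.prod_range_succ, ih]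

lemma poch_half_ne_zero (n : ℕ) : poch (1 / 2) n ≠ 0 := by
  rw [poch_eq_prod, Finset.prod_ne_zero_iff]
  intro j _ h
  have := congrArg Complex.re h
  norm_num at this
  have : (0 : ℝ) ≤ j := j.cast_nonneg
  linarith

lemma tendsto_poch_div (x : ℂ) :
    Tendsto (fun n : ℕ => poch x (n + 1) / ((n : ℂ) ^ x * n.factorial)) atTop
      (𝓝 (Complex.Gamma x)⁻¹) := by
  by_cases hx : ∀ m : ℕ, x ≠ -m
  · refine ((Complex.GammaSeq_tendsto_Gamma x).inv₀ (Complex.Gamma_ne_zero hx)).congr fun n => ?_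
    rw [Complex.GammaSeq, inv_div, poch_eq_prod]
  · push Not at hx
    obtain ⟨m, rfl⟩ := hx
    rw [Complex.Gamma_neg_nat_eq_zero, inv_zero]
    refine tendsto_const_nhds.congr' ?_
    filter_upwards [eventually_ge_atTop m] with n hn
    rw [poch_eq_prod, Finset.prod_eq_zero (Finset.mem_range.mpr (Nat.lt_succ_of_le hn)), zero_div]
    simp

/-- The growth of the Pochhammer symbol. -/
lemma exists_norm_poch_succ_le (x : ℂ) :
    ∃ C : ℝ, 0 ≤ C ∧ ∀ n : ℕ, 1 ≤ n →
      ‖poch x (n + 1)‖ ≤ C * (n : ℝ) ^ x.re * n.factorial := by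
  obtain ⟨C, hC⟩ := (tendsto_poch_div x).norm.bddAbove_range
  refine ⟨C, (norm_nonneg _).trans (hC ⟨0, rfl⟩), fun n hn => ?_⟩
  have hn' : (0 : ℝ) < n := by exact_mod_cast hn
  have h := hC ⟨n, rfl⟩
  have hf : (0 : ℝ) < n.factorial := by exact_mod_cast n.factorial_pos
  simp only [norm_div, norm_mul, Complex.norm_natCast] at h
  rw [Complex.norm_natCast_cpow_of_pos hn, div_le_iff₀ (by positivity)] at h
  linarith

lemma summable_norm_hypergeometric (r : ℕ) (hr : 1 ≤ r) (s : ℂ) (hs : -(r : ℝ) / 2 < s.re) :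
    Summable fun n : ℕ => ‖poch (-s / 2) n * poch ((1 - s) / 2) n * (poch (1 / 2) n) ^ (r - 1) /
        ((n.factorial : ℂ)) ^ (r + 1)‖ := by
  obtain ⟨A, hA, hA'⟩ := exists_norm_poch_succ_le (-s / 2)
  obtain ⟨B, hB, hB'⟩ := exists_norm_poch_succ_le ((1 - s) / 2)
  obtain ⟨C, hC, hC'⟩ := exists_norm_poch_succ_le (1 / 2)
  obtain ⟨q, rfl⟩ : ∃ q, r = q + 1 := ⟨r - 1, by omega⟩
  rw [← summable_nat_add_iff 2]
  have hsum : Summable fun n : ℕ =>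
      A * B * C ^ q * ((n + 1 : ℕ) : ℝ) ^ (-s.re - ((q + 1 : ℕ) : ℝ) / 2 - 1) := by
    refine Summable.mul_left _ ((summable_nat_add_iff 1).mpr (Real.summable_nat_rpow.mpr ?_))
    linarith
  refine Summable.of_nonneg_of_le (fun _ => norm_nonneg _) (fun n => ?_) hsum
  have hf : (0 : ℝ) < (n + 1).factorial := by exact_mod_cast (n + 1).factorial_pos
  have h1 := hA' (n + 1) (by omega)
  have h2 := hB' (n + 1) (by omega)
  have h3 := hC' (n + 1) (by omega)
  set N : ℝ := ((n + 1 : ℕ) : ℝ) with hN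
  have hNpos : 0 < N := by rw [hN]; positivity
  have hfac : ((n + 2).factorial : ℝ) ^ (q + 1 + 1) =
      (N + 1) ^ (q + 2) * ((n + 1).factorial : ℝ) ^ (q + 2) := by
    rw [Nat.factorial_succ (n + 1), ← mul_pow, hN]; push_cast; ring
  have e1 : (-s / 2).re = -s.re / 2 := by simp
  have e2 : ((1 - s) / 2).re = (1 - s.re) / 2 := by simp
  have e3 : ((1 / 2 : ℂ)).re = 1 / 2 := by norm_num
  rw [e1] at h1
  rw [e2] at h2
  rw [e3] at h3
  simp only [norm_div, norm_mul, norm_pow, Complex.norm_natCast, Nat.add_sub_cancel]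
  rw [hfac, div_le_iff₀ (by positivity)]
  calc _ ≤ (A * N ^ (-s.re / 2) * (n + 1).factorial) * (B * N ^ ((1 - s.re) / 2) *
        (n + 1).factorial) * (C * N ^ (1 / 2 : ℝ) * (n + 1).factorial) ^ q := by
        gcongr
    _ = A * B * C ^ q * (N ^ (-s.re / 2) * N ^ ((1 - s.re) / 2) * (N ^ (1 / 2 : ℝ)) ^ q) *
        ((n + 1).factorial : ℝ) ^ (q + 2) := by ring
    _ = A * B * C ^ q * N ^ (-s.re - ((q + 1 : ℕ) : ℝ) / 2 - 1) *
        (N ^ (q + 2) * ((n + 1).factorial : ℝ) ^ (q + 2)) := by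
        have hexp : N ^ (-s.re / 2) * N ^ ((1 - s.re) / 2) * (N ^ (1 / 2 : ℝ)) ^ q =
            N ^ (-s.re - ((q + 1 : ℕ) : ℝ) / 2 - 1) * N ^ (q + 2) := by
          rw [← Real.rpow_natCast (N ^ (1 / 2 : ℝ)), ← Real.rpow_mul hNpos.le,
            ← Real.rpow_natCast N (q + 2), ← Real.rpow_add hNpos, ← Real.rpow_add hNpos,
            ← Real.rpow_add hNpos]
          congr 1
          push_cast
          ring
        rw [hexp]
        ring
    _ ≤ _ := by
        gcongr
        linarith

lemma Ring.choose_succ_mul_succ (s : ℂ) (n : ℕ) :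
    Ring.choose s (n + 1) * (n + 1) = Ring.choose s n * (s - n) := by
  have hf : (n.factorial : ℂ) ≠ 0 := by exact_mod_cast n.factorial_ne_zero
  have hn : (n + 1 : ℂ) ≠ 0 := by exact_mod_cast n.succ_ne_zero
  rw [Ring.choose_eq_smul, Ring.choose_eq_smul, descPochhammer_succ_right, Polynomial.smeval_mul,
    Polynomial.smeval_sub, Polynomial.smeval_X, Polynomial.smeval_natCast, Nat.factorial_succ]
  simp only [smul_eq_mul, pow_one, pow_zero, nsmul_eq_mul, mul_one]
  push_cast
  field_simp

lemma choose_two_mul (s : ℂ) (n : ℕ) :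
    Ring.choose s (2 * n) =
      poch (-s / 2) n * poch ((1 - s) / 2) n / (poch (1 / 2) n * n.factorial) := by
  induction n with
  | zero => simp [poch_zero]
  | succ n ih =>
    have h1 := Ring.choose_succ_mul_succ s (2 * n)
    have h2 := Ring.choose_succ_mul_succ s (2 * n + 1)
    have hf : (n.factorial : ℂ) ≠ 0 := by exact_mod_cast n.factorial_ne_zero
    have hp := poch_half_ne_zero n
    have hn : (n + 1 : ℂ) ≠ 0 := by exact_mod_cast n.succ_ne_zero
    have hn1 : (2 * n + 1 : ℂ) ≠ 0 := by exact_mod_cast (2 * n).succ_ne_zero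
    have hn2 : (2 * n + 1 + 1 : ℂ) ≠ 0 := by exact_mod_cast (2 * n + 1).succ_ne_zero
    have hn3 : (1 / 2 + n : ℂ) = (2 * n + 1) / 2 := by ring
    push_cast at h1 h2
    rw [show 2 * (n + 1) = 2 * n + 1 + 1 by ring, eq_div_of_mul_eq hn2 h2,
      eq_div_of_mul_eq hn1 h1, ih, poch_succ, poch_succ, poch_succ, hn3, Nat.factorial_succ]
    push_cast
    field_simp
    ring

lemma norm_choose_succ_le (s : ℂ) (n : ℕ) :
    ‖Ring.choose s (n + 1)‖ ≤ (‖s‖ + 1) * ‖Ring.choose s n‖ := by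
  have h := congrArg norm (Ring.choose_succ_mul_succ s n)
  have hn : ‖(n + 1 : ℂ)‖ = n + 1 := by exact_mod_cast Complex.norm_natCast (n + 1)
  have h1 : ‖s - n‖ ≤ (‖s‖ + 1) * (n + 1) := by
    refine (norm_sub_le _ _).trans ?_
    rw [Complex.norm_natCast]
    nlinarith [norm_nonneg s, (n.cast_nonneg : (0 : ℝ) ≤ n)]
  rw [norm_mul, norm_mul, hn] at h
  have h2 : ‖Ring.choose s (n + 1)‖ * (n + 1) ≤ (‖s‖ + 1) * ‖Ring.choose s n‖ * (n + 1) := by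
    rw [h]
    nlinarith [mul_le_mul_of_nonneg_left h1 (norm_nonneg (Ring.choose s n))]
  exact le_of_mul_le_mul_right h2 (by positivity)

/-- The binomial series, with consecutive terms grouped in pairs. -/
lemma hasSum_binomial_pairs (s : ℂ) (x : ℝ) (hx : |x| < 1) :
    HasSum (fun n : ℕ =>
      (Ring.choose s (2 * n) + Ring.choose s (2 * n + 1) * x) * (x : ℂ) ^ (2 * n))
      ((1 + (x : ℂ)) ^ s) := by
  have hx' : (x : ℂ) ∈ Metric.eball (0 : ℂ) 1 := by
    simpa [Metric.mem_eball, edist_eq_enorm_sub, ← ofReal_norm] using hx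
  have h := (Complex.one_add_cpow_hasFPowerSeriesOnBall_zero (a := s)).hasSum hx'
  have h' : HasSum (fun n : ℕ => Ring.choose s n * (x : ℂ) ^ n) ((1 + (x : ℂ)) ^ s) := by
    simpa only [zero_add, binomialSeries_apply, List.ofFn_const, List.prod_replicate,
      smul_eq_mul] using h
  clear h
  have he : Summable fun n : ℕ => Ring.choose s (2 * n) * (x : ℂ) ^ (2 * n) :=
    h'.summable.comp_injective (i := fun n : ℕ => 2 * n) fun a b hab => by
      simpa using hab
  have ho : Summable fun n : ℕ => Ring.choose s (2 * n + 1) * (x : ℂ) ^ (2 * n + 1) :=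
    h'.summable.comp_injective (i := fun n : ℕ => 2 * n + 1) fun a b hab => by
      simpa using hab
  have hsum := HasSum.even_add_odd (f := fun n : ℕ => Ring.choose s n * (x : ℂ) ^ n)
    he.hasSum ho.hasSum
  rw [h'.unique hsum]
  convert he.hasSum.add ho.hasSum using 1
  ext n
  rw [pow_succ]
  ring

lemma integral_cos_pow_add_two (m : ℕ) :
    ∫ x in (0 : ℝ)..2 * π, cos x ^ (m + 2) =
      (m + 1) / (m + 2) * ∫ x in (0 : ℝ)..2 * π, cos x ^ m := by
  simp [integral_cos_pow]

lemma integral_cos_pow_odd (n : ℕ) : ∫ x in (0 : ℝ)..2 * π, cos x ^ (2 * n + 1) = 0 := by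
  induction n with
  | zero => simp
  | succ n ih =>
    rw [show 2 * (n + 1) + 1 = 2 * n + 1 + 2 by ring, integral_cos_pow_add_two, ih, mul_zero]

lemma integral_cos_pow_even (n : ℕ) :
    ((∫ x in (0 : ℝ)..2 * π, cos x ^ (2 * n) : ℝ) : ℂ) =
      ((2 * π : ℝ) : ℂ) * (poch (1 / 2) n / n.factorial) := by
  induction n with
  | zero => simp [poch_zero]
  | succ n ih =>
    have hf : (n.factorial : ℂ) ≠ 0 := by exact_mod_cast n.factorial_ne_zero
    have hn : (n + 1 : ℂ) ≠ 0 := by exact_mod_cast n.succ_ne_zero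
    have hn2 : (2 * n + 2 : ℂ) ≠ 0 := by exact_mod_cast (2 * n + 1).succ_ne_zero
    rw [show 2 * (n + 1) = 2 * n + 2 by ring, integral_cos_pow_add_two, Complex.ofReal_mul, ih,
      poch_succ, Nat.factorial_succ]
    push_cast
    field_simp
    ring

/-- Lebesgue measure on the cube `[0, 2π]^r`, as a product measure. -/
noncomputable abbrev cubeMeasure (r : ℕ) : Measure (Fin r → ℝ) :=
  Measure.pi fun _ => volume.restrict (Set.Icc 0 (2 * π))

lemma integral_prod_cos_pow (r m : ℕ) :
    ∫ θ, (∏ i, cos (θ i)) ^ m ∂cubeMeasure r = (∫ x in (0 : ℝ)..2 * π, cos x ^ m) ^ r := by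
  simp_rw [← Finset.prod_pow]
  rw [integral_fin_nat_prod_eq_prod (fun _ x => cos x ^ m)]
  simp [intervalIntegral.integral_of_le two_pi_pos.le, integral_Icc_eq_integral_Ioc]

lemma abs_prod_cos_le_one {r : ℕ} (θ : Fin r → ℝ) : |∏ i, cos (θ i)| ≤ 1 := by
  rw [Finset.abs_prod]
  exact Finset.prod_le_one (fun _ _ => abs_nonneg _) fun _ _ => abs_cos_le_one _

lemma integrable_prod_cos_pow (r m : ℕ) :
    Integrable (fun θ => (∏ i, cos (θ i)) ^ m) (cubeMeasure r) := by
  refine Integrable.of_bound (C := 1)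
    (Continuous.aestronglyMeasurable (by fun_prop)) (ae_of_all _ fun θ => ?_)
  rw [norm_pow]
  exact pow_le_one₀ (norm_nonneg _) (abs_prod_cos_le_one θ)

lemma ae_abs_prod_cos_lt_one (r : ℕ) (hr : 1 ≤ r) :
    ∀ᵐ θ ∂cubeMeasure r, |∏ i, cos (θ i)| < 1 := by
  have h : ∀ᵐ x ∂(volume.restrict (Set.Icc 0 (2 * π))), sin x ≠ 0 := by
    refine ae_restrict_of_ae ?_
    have hc : (Set.range fun n : ℤ => (n : ℝ) * π).Countable := Set.countable_range _
    filter_upwards [hc.ae_notMem volume] with x hx h0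
    exact hx (sin_eq_zero_iff.mp h0)
  filter_upwards [(Measure.quasiMeasurePreserving_eval
    (fun _ : Fin r => volume.restrict (Set.Icc 0 (2 * π))) ⟨0, hr⟩).ae h] with θ hθ
  rw [Finset.abs_prod, ← Finset.mul_prod_erase _ _ (Finset.mem_univ ⟨0, hr⟩)]
  refine mul_lt_one_of_nonneg_of_lt_one_left (abs_nonneg _) ?_
    (Finset.prod_le_one (fun _ _ => abs_nonneg _) fun _ _ => abs_cos_le_one _)
  rw [← sq_lt_one_iff_abs_lt_one]
  have := sin_sq_add_cos_sq (θ ⟨0, hr⟩)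
  have := pow_pos (abs_pos.mpr hθ) 2
  rw [sq_abs] at this
  simp only [Function.eval] at this
  linarith

lemma cpow0_two_pow_mul (r : ℕ) (s : ℂ) {x : ℝ} (hx : 0 < x) :
    cpow0 (2 ^ r * x) s = Complex.exp ((r : ℂ) * s * (Real.log 2 : ℂ)) * (x : ℂ) ^ s := by
  have hx' : (x : ℂ) ≠ 0 := by exact_mod_cast hx.ne'
  rw [cpow0, if_neg (by positivity), Real.log_mul (by positivity) hx.ne', Real.log_pow,
    Complex.cpow_def_of_ne_zero hx', ← Complex.ofReal_log hx.le, ← Complex.exp_add]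
  congr 1
  push_cast
  ring

/-- For `r ≥ 1`, `|k| = 2^r` and `Re(s) > −r/2`:
`W_r(k;s) = 2^{rs} · ₍r+1₎F_r(−s/2, (1−s)/2, 1/2, …, 1/2; 1, …, 1; 1)`. -/
theorem stmt7 (r : ℕ) (hr : 1 ≤ r) (k : ℝ) (hk : |k| = 2 ^ r) (s : ℂ)
    (hs : -(r : ℝ) / 2 < s.re) :
    Wr r k s = Complex.exp ((r : ℂ) * s * (Real.log 2 : ℂ)) *
      ∑' n : ℕ, poch (-s / 2) n * poch ((1 - s) / 2) n * (poch (1/2) n) ^ (r - 1) /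
        ((n.factorial : ℂ)) ^ (r + 1) := by
  obtain ⟨e, he, hke⟩ : ∃ e : ℝ, |e| = 1 ∧ k = e * 2 ^ r := by
    rcases abs_eq (by positivity) |>.mp hk with h | h
    · exact ⟨1, by simp, by simp [h]⟩
    · exact ⟨-1, by simp, by simp [h]⟩
  have hee : e * e = 1 := by rw [← abs_mul_abs_self, he, one_mul]
  set X : (Fin r → ℝ) → ℝ := fun θ => ∏ i, cos (θ i) with hX
  have heX (θ) : |e * X θ| = |X θ| := by rw [abs_mul, he, one_mul]
  have hpt (θ) (h : |X θ| < 1) : cpow0 |k + ∏ i, 2 * cos (θ i)| s =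
      Complex.exp ((r : ℂ) * s * (Real.log 2 : ℂ)) * (1 + ((e * X θ : ℝ) : ℂ)) ^ s := by
    have hpos : 0 < 1 + e * X θ := by
      have := neg_abs_le (e * X θ)
      rw [heX] at this
      linarith
    have hprod : k + ∏ i, 2 * cos (θ i) = e * (2 ^ r * (1 + e * X θ)) := by
      rw [Finset.prod_mul_distrib, hke]
      simp only [Finset.prod_const, Finset.card_univ, Fintype.card_fin]
      linear_combination (-(2 ^ r * X θ)) * hee
    rw [hprod, abs_mul, he, one_mul, abs_of_pos (by positivity), cpow0_two_pow_mul r s hpos]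
    push_cast
    rfl
  let F : ℕ → (Fin r → ℝ) → ℂ := fun n θ =>
    (Ring.choose s (2 * n) + Ring.choose s (2 * n + 1) * ((e * X θ : ℝ) : ℂ)) *
      ((e * X θ : ℝ) : ℂ) ^ (2 * n)
  have he2 (n : ℕ) : e ^ (2 * n) = 1 := by rw [pow_mul, pow_two, hee, one_pow]
  have hF (n) (θ) : F n θ = Ring.choose s (2 * n) * ((X θ ^ (2 * n) : ℝ) : ℂ) +
      Ring.choose s (2 * n + 1) * e * ((X θ ^ (2 * n + 1) : ℝ) : ℂ) := by
    have : (e : ℂ) ^ (2 * n) = 1 := by exact_mod_cast he2 n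
    simp only [F]
    push_cast
    rw [mul_pow, this]
    ring
  have hXint (m : ℕ) : Integrable (fun θ => ((X θ ^ m : ℝ) : ℂ)) (cubeMeasure r) :=
    (integrable_prod_cos_pow r m).ofReal
  have hFint (n) : Integrable (F n) (cubeMeasure r) := by
    rw [show F n = _ from funext (hF n)]
    exact ((hXint _).const_mul _).add ((hXint _).const_mul _)
  have hr0 : r ≠ 0 := by omega
  have hterm (n : ℕ) : Ring.choose s (2 * n) *
      ((∫ θ, X θ ^ (2 * n) ∂cubeMeasure r : ℝ) : ℂ) = ((2 * π : ℝ) : ℂ) ^ r *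
        (poch (-s / 2) n * poch ((1 - s) / 2) n * (poch (1 / 2) n) ^ (r - 1) /
        ((n.factorial : ℂ)) ^ (r + 1)) := by
    have hf : (n.factorial : ℂ) ≠ 0 := by exact_mod_cast n.factorial_ne_zero
    have hp := poch_half_ne_zero n
    obtain ⟨q, rfl⟩ : ∃ q, r = q + 1 := ⟨r - 1, by omega⟩
    rw [hX, integral_prod_cos_pow, Complex.ofReal_pow, integral_cos_pow_even, choose_two_mul,
      mul_pow, div_pow, Nat.add_sub_cancel]
    field_simp
    ring
  have hIF (n) : ∫ θ, F n θ ∂cubeMeasure r = ((2 * π : ℝ) : ℂ) ^ r *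
        (poch (-s / 2) n * poch ((1 - s) / 2) n * (poch (1 / 2) n) ^ (r - 1) /
        ((n.factorial : ℂ)) ^ (r + 1)) := by
    simp_rw [hF]
    rw [integral_add ((hXint _).const_mul _) ((hXint _).const_mul _), integral_const_mul,
      integral_const_mul, integral_complex_ofReal, integral_complex_ofReal, hterm,
      hX, integral_prod_cos_pow, integral_cos_pow_odd, zero_pow hr0]
    simp
  have hbound (n) (θ) : ‖F n θ‖ ≤ (‖s‖ + 2) * ‖Ring.choose s (2 * n)‖ * X θ ^ (2 * n) := by
    have h1 : ‖((e * X θ : ℝ) : ℂ) ^ (2 * n)‖ = X θ ^ (2 * n) := by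
      rw [norm_pow, Complex.norm_real, Real.norm_eq_abs, heX, pow_mul, sq_abs, ← pow_mul]
    have h2 : ‖((e * X θ : ℝ) : ℂ)‖ ≤ 1 := by
      rw [Complex.norm_real, Real.norm_eq_abs, heX]
      exact abs_prod_cos_le_one θ
    have h3 : 0 ≤ X θ ^ (2 * n) := by rw [← h1]; exact norm_nonneg _
    simp only [F]
    rw [norm_mul, h1]
    refine mul_le_mul_of_nonneg_right ((norm_add_le _ _).trans ?_) h3
    rw [norm_mul]
    have h4 := mul_le_mul (norm_choose_succ_le s (2 * n)) h2 (norm_nonneg _) (by positivity)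
    linarith
  have hsum : Summable fun n => ∫ θ, ‖F n θ‖ ∂cubeMeasure r := by
    refine Summable.of_nonneg_of_le (fun n => integral_nonneg fun _ => norm_nonneg _) (fun n => ?_)
      ((summable_norm_hypergeometric r hr s hs).mul_left ((‖s‖ + 2) * ‖((2 * π : ℝ) : ℂ) ^ r‖))
    have hnn : 0 ≤ ∫ θ, X θ ^ (2 * n) ∂cubeMeasure r :=
      integral_nonneg fun θ => by simp only [pow_mul]; positivity
    rw [mul_assoc, ← norm_mul, ← hterm, norm_mul, Complex.norm_real, Real.norm_of_nonneg hnn,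
      ← mul_assoc, ← integral_const_mul]
    exact integral_mono (hFint n).norm ((integrable_prod_cos_pow r _).const_mul _) (hbound n)
  have hmain := (hasSum_integral_of_summable_integral_norm hFint hsum).tsum_eq
  simp_rw [hIF, tsum_mul_left] at hmain
  have hW : ∫ θ : Fin r → ℝ in Set.univ.pi fun _ => Set.Icc 0 (2 * π),
      cpow0 |k + ∏ i, 2 * cos (θ i)| s =
      Complex.exp ((r : ℂ) * s * (Real.log 2 : ℂ)) * ∫ θ, ∑' n, F n θ ∂cubeMeasure r := by
    rw [volume_pi, Measure.restrict_pi_pi, ← integral_const_mul]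
    refine integral_congr_ae ?_
    filter_upwards [ae_abs_prod_cos_lt_one r hr] with θ hθ
    rw [hpt θ hθ, (hasSum_binomial_pairs s (e * X θ) (by rw [heX]; exact hθ)).tsum_eq]
  rw [Wr, hW, ← hmain, mul_left_comm, ← mul_assoc (_ ^ r), ← mul_pow, inv_mul_cancel₀, one_pow,
    one_mul]
  exact_mod_cast two_pi_pos.ne'
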